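/- Suppose n ≥ 2 and τ_1,…,τ_r ∈ 𝕋 satisfy (n+1)Δ(τ) ≥ α for some α > 0, and let u_{i,j} be reals with (n+1) max_{i≠j}|u_{i,j}| = β < α/2. Then for every i, ∑_{j≠i} |F_N'(τ_j − τ_i + u_{i,j})| ≤ C_1 (n+1) ((n+1)Δ(τ))^{-2}, with C_1 = ((4/π)(α−2β)^{-1} + (8/π²)(α−2β)^{-2}) α. -/

import Mathlib

open Real

/-- The normalized Fejér kernel of order `N = 2n+1`:
`F_N(t) = (1/(n+1)) ∑_{k=-n}^{n} (1 - |k|/(n+1)) e^{i2πkt}`, written in its real (cosine) form. -/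
noncomputable def fejer (n : ℕ) (t : ℝ) : ℝ :=
  (1 / (n + 1)) * ∑ k ∈ Finset.Icc (-(n : ℤ)) n, (1 - |(k : ℝ)| / (n + 1)) * Real.cos (2 * π * k * t)

/-- The minimal wrap-around distance `Δ(τ) = min_{ℓ≠ℓ'} inf_{p∈ℤ} |τ_ℓ − τ_{ℓ'} + p|`. -/
noncomputable def sep {r : ℕ} (τ : Fin r → ℝ) : ℝ :=
  sInf {d : ℝ | ∃ (i j : Fin r) (p : ℤ), i ≠ j ∧ d = |τ i - τ j + p|}

/-- The closed form of the Dirichlet kernel. -/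
theorem sum_cos_mul_sin (n : ℕ) (x : ℝ) :
    (∑ k ∈ Finset.Icc (-(n : ℤ)) n, cos (2 * k * x)) * sin x = sin ((2 * n + 1) * x) := by
  induction n with
  | zero => simp
  | succ n ih =>
    rw [Nat.cast_add, Nat.cast_one, Finset.Icc_succ_succ, Finset.sum_union (by simp),
      Finset.sum_pair (by lia), add_mul, ih]
    push_cast
    rw [show 2 * (-((n : ℝ) + 1)) * x = -(2 * (n + 1) * x) by ring, cos_neg,
      show (2 * (n : ℝ) + 1) * x = 2 * (n + 1) * x - x by ring,
      show (2 * ((n : ℝ) + 1) + 1) * x = 2 * (n + 1) * x + x by ring, sin_sub, sin_add]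
    ring

/-- The closed form of the Fejér kernel. -/
theorem sum_fejer_cos_mul_sin_sq (n : ℕ) (x : ℝ) :
    (∑ k ∈ Finset.Icc (-(n : ℤ)) n, ((n : ℝ) + 1 - |(k : ℝ)|) * cos (2 * k * x)) * sin x ^ 2 =
      sin ((n + 1) * x) ^ 2 := by
  induction n with
  | zero => simp
  | succ n ih =>
    have hstep : ∑ k ∈ Finset.Icc (-((n + 1 : ℕ) : ℤ)) (n + 1 : ℕ),
          (((n + 1 : ℕ) : ℝ) + 1 - |(k : ℝ)|) * cos (2 * k * x) =
        ∑ k ∈ Finset.Icc (-(n : ℤ)) n, ((n : ℝ) + 1 - |(k : ℝ)|) * cos (2 * k * x) +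
          ∑ k ∈ Finset.Icc (-((n + 1 : ℕ) : ℤ)) (n + 1 : ℕ), cos (2 * k * x) := by
      rw [Nat.cast_add, Nat.cast_one, Finset.Icc_succ_succ, Finset.sum_union (by simp),
        Finset.sum_union (by simp), Finset.sum_pair (by lia), Finset.sum_pair (by lia),
        ← add_assoc (Finset.sum _ _) (Finset.sum _ _), ← Finset.sum_add_distrib]
      have : |((n : ℝ) + 1)| = n + 1 := abs_of_nonneg (by positivity)
      push_cast
      rw [abs_neg, this]
      congr 1
      · exact Finset.sum_congr rfl fun k _ => by ring
      · ring
    rw [hstep, add_mul, ih, sq (sin x), ← mul_assoc _ (sin x) (sin x), sum_cos_mul_sin]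
    push_cast
    set y := ((n : ℝ) + 1) * x
    rw [show (2 * ((n : ℝ) + 1) + 1) * x = y + (y + x) by ring,
      show ((n : ℝ) + 1 + 1) * x = y + x by ring]
    have hx : sin x = sin (y + x) * cos y - cos (y + x) * sin y := by
      rw [← sin_sub]; congr 1; ring
    rw [hx, sin_add y (y + x)]
    linear_combination sin (y + x) ^ 2 * sin_sq_add_cos_sq y -
      sin y ^ 2 * sin_sq_add_cos_sq (y + x)

theorem fejer_mul_sin_sq (n : ℕ) (t : ℝ) :
    fejer n t * sin (π * t) ^ 2 = sin ((n + 1) * (π * t)) ^ 2 / (n + 1) ^ 2 := by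
  have hM : (n : ℝ) + 1 ≠ 0 := by positivity
  rw [← sum_fejer_cos_mul_sin_sq, fejer, mul_div_right_comm, Finset.mul_sum, Finset.sum_div]
  congr 1
  refine Finset.sum_congr rfl fun k _ => ?_
  rw [show 2 * π * k * t = 2 * k * (π * t) by ring]
  field_simp

theorem differentiable_fejer (n : ℕ) : Differentiable ℝ (fejer n) := by
  unfold fejer
  fun_prop

theorem fejer_add_intCast (n : ℕ) (t : ℝ) (p : ℤ) : fejer n (t + p) = fejer n t := by
  unfold fejer
  congr 1
  refine Finset.sum_congr rfl fun k _ => ?_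
  rw [show 2 * π * k * (t + p) = 2 * π * k * t + (k * p : ℤ) * (2 * π) by push_cast; ring,
    cos_add_int_mul_two_pi]

theorem deriv_fejer_add_intCast (n : ℕ) (t : ℝ) (p : ℤ) :
    deriv (fejer n) (t + p) = deriv (fejer n) t := by
  rw [← deriv_comp_add_const]
  simp only [fejer_add_intCast]

/-- A majorant of `|F_N'(t)|`, in terms of `M = n + 1` and `w = cot (π t)`. -/
noncomputable def fejerMajorant (M w : ℝ) : ℝ :=
  π * (1 + w ^ 2) / M + 2 * π * |w| * (1 + w ^ 2) / M ^ 2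

theorem one_add_cot_sq {x : ℝ} (hx : sin x ≠ 0) : 1 + cot x ^ 2 = 1 / sin x ^ 2 := by
  rw [cot_eq_cos_div_sin]
  field_simp
  exact sin_sq_add_cos_sq x

theorem abs_deriv_fejer_le (n : ℕ) {t : ℝ} (ht : sin (π * t) ≠ 0) :
    |deriv (fejer n) t| ≤ fejerMajorant (n + 1) (cot (π * t)) := by
  have hM : (0 : ℝ) < n + 1 := by positivity
  set s := sin (π * t) with hs
  set c := cos (π * t) with hc
  set S := sin ((n + 1) * (π * t)) with hS
  set C := cos ((n + 1) * (π * t)) with hC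
  have hlin : HasDerivAt (fun t : ℝ => π * t) π t := by
    simpa using (hasDerivAt_id t).const_mul π
  have h1 := ((differentiable_fejer n t).hasDerivAt).mul ((hlin.sin).pow 2)
  have h2 := (((hlin.const_mul ((n : ℝ) + 1)).sin).pow 2).div_const (((n : ℝ) + 1) ^ 2)
  have heq := h1.unique (h2.congr_of_eventuallyEq (.of_forall fun t => fejer_mul_sin_sq n t))
  have hF := fejer_mul_sin_sq n t
  simp only [← hs, ← hc, ← hS, ← hC] at heq hF
  have hF' : fejer n t = S ^ 2 / (n + 1) ^ 2 / s ^ 2 := by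
    rw [← hF]; field_simp
  have hd : deriv (fejer n) t =
      π * (2 * S * C) / (n + 1) / s ^ 2 - 2 * π * (c / s) * S ^ 2 / s ^ 2 / (n + 1) ^ 2 := by
    rw [hF'] at heq
    norm_num at heq
    field_simp at heq ⊢
    linear_combination heq
  rw [fejerMajorant, one_add_cot_sq ht, ← hs, cot_eq_cos_div_sin, ← hs, ← hc, hd]
  refine (abs_sub _ _).trans (add_le_add ?_ ?_)
  · rw [hS, hC, ← sin_two_mul, abs_div, abs_div, abs_mul, abs_of_pos pi_pos, abs_of_pos hM,
      abs_of_nonneg (sq_nonneg s), mul_one_div, div_right_comm]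
    gcongr
    exact mul_le_of_le_one_right pi_pos.le (abs_sin_le_one _)
  · have hS1 : S ^ 2 ≤ 1 := sin_sq_le_one _
    rw [abs_div, abs_div, abs_mul, abs_mul, abs_of_pos two_pi_pos,
      abs_of_nonneg (sq_nonneg s), abs_of_nonneg (sq_nonneg S), abs_of_pos (pow_pos hM 2),
      mul_one_div]
    gcongr ?_ / s ^ 2 / _
    exact mul_le_of_le_one_right (by positivity) hS1

theorem cot_sub_cot {x y : ℝ} (hx : sin x ≠ 0) (hy : sin y ≠ 0) :
    cot x - cot y = sin (y - x) / (sin x * sin y) := by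
  rw [cot_eq_cos_div_sin, cot_eq_cos_div_sin, sin_sub]
  field_simp

theorem cot_add_cot {x y : ℝ} (hx : sin x ≠ 0) (hy : sin y ≠ 0) :
    cot x + cot y = sin (x + y) / (sin x * sin y) := by
  rw [cot_eq_cos_div_sin, cot_eq_cos_div_sin, sin_add]
  field_simp
  ring

theorem cot_pi_sub (x : ℝ) : cot (π - x) = -cot x := by
  rw [cot_eq_cos_div_sin, cot_eq_cos_div_sin, cos_pi_sub, sin_pi_sub, neg_div]

theorem antitoneOn_cot : AntitoneOn cot (Set.Ioo 0 π) := by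
  intro x hx y hy hxy
  have h1 := sin_pos_of_mem_Ioo hx
  have h2 := sin_pos_of_mem_Ioo hy
  rw [← sub_nonneg, cot_sub_cot h1.ne' h2.ne']
  exact div_nonneg (sin_nonneg_of_nonneg_of_le_pi (by linarith) (by linarith [hx.1, hy.2]))
    (by positivity)

theorem abs_cot_le {x y : ℝ} (hx : 0 < x) (hy : y ∈ Set.Icc x (π - x)) :
    |cot y| ≤ cot x := by
  have hm : ∀ z ∈ Set.Icc x (π - x), z ∈ Set.Ioo 0 π := fun z hz =>
    ⟨by linarith [hz.1], by linarith [hz.2]⟩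
  have hle := hy.1.trans hy.2
  rw [abs_le, ← cot_pi_sub]
  exact ⟨antitoneOn_cot (hm y hy) (hm _ ⟨hle, le_rfl⟩) hy.2,
    antitoneOn_cot (hm x ⟨le_rfl, hle⟩) (hm y hy) hy.1⟩

theorem sin_add_mul_sin_sub (x h : ℝ) :
    sin (x - h) * sin (x + h) = sin x ^ 2 - sin h ^ 2 := by
  rw [sin_sub, sin_add]
  linear_combination (sin x ^ 2) * sin_sq_add_cos_sq h - (sin h ^ 2) * sin_sq_add_cos_sq x

theorem two_mul_le_cot_sub_cot {x h : ℝ} (hh : 0 < h) (h1 : 0 < x - h) (h2 : x + h < π) :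
    2 * h * (1 + cot x ^ 2) ≤ cot (x - h) - cot (x + h) := by
  have s1 : 0 < sin (x - h) := sin_pos_of_pos_of_lt_pi h1 (by linarith)
  have s2 : 0 < sin (x + h) := sin_pos_of_pos_of_lt_pi (by linarith) h2
  have s0 : 0 < sin x := sin_pos_of_pos_of_lt_pi (by linarith) (by linarith)
  have hc : 0 < cos h := cos_pos_of_mem_Ioo ⟨by linarith, by linarith⟩
  have htan : h * cos h ≤ sin h := by
    have := le_tan hh.le (by linarith)
    rwa [tan_eq_sin_div_cos, le_div_iff₀ hc] at this
  rw [cot_sub_cot s1.ne' s2.ne', one_add_cot_sq s0.ne', sin_add_mul_sin_sub,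
    show x + h - (x - h) = 2 * h by ring, sin_two_mul, mul_one_div,
    div_le_div_iff₀ (by positivity) (by rw [← sin_add_mul_sin_sub]; positivity)]
  have e1 : h * cos h ^ 2 ≤ sin h * cos h := by nlinarith
  have e2 : 0 ≤ h * sin h ^ 2 * cos x ^ 2 := by positivity
  have e3 : h * (sin x ^ 2 - sin h ^ 2) =
      h * cos h ^ 2 * sin x ^ 2 - h * sin h ^ 2 * cos x ^ 2 := by
    rw [cos_sq', cos_sq']; ring
  linarith [mul_le_mul_of_nonneg_right e1 (sq_nonneg (sin x))]

theorem two_mul_abs_cot_le {x h : ℝ} (hh : 0 < h) (h1 : 0 < x - h) (h2 : x + h < π) :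
    2 * |cot x| ≤ |cot (x - h) + cot (x + h)| := by
  have s1 : 0 < sin (x - h) := sin_pos_of_pos_of_lt_pi h1 (by linarith)
  have s2 : 0 < sin (x + h) := sin_pos_of_pos_of_lt_pi (by linarith) h2
  have s0 : 0 < sin x := sin_pos_of_pos_of_lt_pi (by linarith) (by linarith)
  have hp : 0 < sin (x - h) * sin (x + h) := by positivity
  rw [cot_add_cot s1.ne' s2.ne', abs_div, abs_of_pos hp, le_div_iff₀ hp,
    show x - h + (x + h) = 2 * x by ring, sin_two_mul, cot_eq_cos_div_sin, abs_div, abs_mul,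
    abs_mul, abs_of_pos s0, abs_two]
  calc 2 * (|cos x| / sin x) * (sin (x - h) * sin (x + h))
      ≤ 2 * (|cos x| / sin x) * sin x ^ 2 := by
        gcongr
        rw [sin_add_mul_sin_sub]
        linarith [sq_nonneg (sin h)]
    _ = 2 * sin x * |cos x| := by field_simp

/-- The function whose composition with `t ↦ cot (π t)` is minus an antiderivative of
`t ↦ fejerMajorant M (cot (π t))`. -/
noncomputable def fejerPotential (M w : ℝ) : ℝ :=
  w / M + w * |w| / M ^ 2

theorem sub_mul_abs_add_le {a b : ℝ} (h : b ≤ a) :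
    (a - b) * |a + b| ≤ a * |a| - b * |b| := by
  rcases abs_cases a with ⟨ha, _⟩ | ⟨ha, _⟩ <;> rcases abs_cases b with ⟨hb, _⟩ | ⟨hb, _⟩ <;>
    rcases abs_cases (a + b) with ⟨hab, _⟩ | ⟨hab, _⟩ <;> rw [ha, hb, hab] <;> nlinarith

theorem fejerPotential_mono {M : ℝ} (hM : 0 < M) : Monotone (fejerPotential M) := by
  intro a b hab
  have := (mul_nonneg (sub_nonneg.2 hab) (abs_nonneg _)).trans (sub_mul_abs_add_le hab)
  unfold fejerPotential
  gcongr ?_ / _ + ?_ / _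
  linarith

theorem fejerPotential_neg (M w : ℝ) : fejerPotential M (-w) = -fejerPotential M w := by
  rw [fejerPotential, fejerPotential, abs_neg]
  ring

theorem mul_fejerMajorant_le {M d x : ℝ} (hM : 0 < M) (hd : 0 < d) (h1 : 0 < x - d / 2)
    (h2 : x + d / 2 < 1) :
    d * fejerMajorant M (cot (π * x)) ≤
      fejerPotential M (cot (π * (x - d / 2))) - fejerPotential M (cot (π * (x + d / 2))) := by
  have hh : 0 < π * (d / 2) := by positivity
  have l1 : 0 < π * x - π * (d / 2) := by rw [← mul_sub]; positivity
  have l2 : π * x + π * (d / 2) < π := by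
    rw [← mul_add]; exact mul_lt_of_lt_one_right pi_pos h2
  have k1 := two_mul_le_cot_sub_cot hh l1 l2
  have k2 := two_mul_abs_cot_le hh l1 l2
  rw [← mul_sub, ← mul_add] at k1 k2
  set w := cot (π * x)
  set A := cot (π * (x - d / 2))
  set B := cot (π * (x + d / 2))
  have hAB : B ≤ A := by
    have : 0 ≤ 2 * (π * (d / 2)) * (1 + w ^ 2) := by positivity
    linarith
  have k3 : 2 * (π * (d / 2)) * (1 + w ^ 2) * (2 * |w|) ≤ A * |A| - B * |B| :=
    (mul_le_mul k1 k2 (by positivity) (by linarith)).trans (sub_mul_abs_add_le hAB)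
  calc d * fejerMajorant M w
      = 2 * (π * (d / 2)) * (1 + w ^ 2) / M +
          2 * (π * (d / 2)) * (1 + w ^ 2) * (2 * |w|) / M ^ 2 := by
        unfold fejerMajorant; ring
    _ ≤ (A - B) / M + (A * |A| - B * |B|) / M ^ 2 := by gcongr
    _ = _ := by unfold fejerPotential; ring

theorem mul_sum_fejerMajorant_le {M d b : ℝ} (hM : 0 < M) (hd : 0 < d) (hb : 2 * b < d) (K : ℕ)
    (hK : d / 2 - b + K * d < 1) :
    d * ∑ k ∈ Finset.Icc 1 K, fejerMajorant M (cot (π * (k * d - b))) ≤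
      fejerPotential M (cot (π * (d / 2 - b))) -
        fejerPotential M (cot (π * (d / 2 - b + K * d))) := by
  induction K with
  | zero => simp
  | succ K ih =>
    push_cast at hK
    have hKd : 0 ≤ K * d := by positivity
    have hm := mul_fejerMajorant_le (M := M) (x := (K + 1) * d - b) hM hd
      (by linarith) (by linarith)
    rw [Finset.sum_Icc_succ_top (by lia), mul_add]
    push_cast
    rw [show ((K : ℝ) + 1) * d - b - d / 2 = d / 2 - b + K * d by ring,
      show ((K : ℝ) + 1) * d - b + d / 2 = d / 2 - b + (K + 1) * d by ring] at hm
    linarith [ih (by linarith)]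

theorem fejerMajorant_nonneg {M : ℝ} (hM : 0 < M) (w : ℝ) : 0 ≤ fejerMajorant M w := by
  unfold fejerMajorant
  positivity

theorem fejerMajorant_le {M v w : ℝ} (hM : 0 < M) (h : |v| ≤ w) :
    fejerMajorant M v ≤ fejerMajorant M w := by
  have hw : |v| ≤ |w| := h.trans (le_abs_self w)
  have hsq : v ^ 2 ≤ w ^ 2 := sq_le_sq.2 hw
  unfold fejerMajorant
  gcongr

theorem abs_deriv_fejer_neg (n : ℕ) (t : ℝ) : |deriv (fejer n) (-t)| = |deriv (fejer n) t| := by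
  have heven : (fun x => fejer n (-x)) = fejer n := by
    funext x
    simp [fejer]
  have h := deriv_comp_neg (fejer n) t
  rw [heven] at h
  rw [h, abs_neg]

theorem abs_deriv_fejer_le_of_mem_Icc (n : ℕ) {c y : ℝ} (hc : 0 < c)
    (hy : y ∈ Set.Icc c (1 - c)) :
    |deriv (fejer n) y| ≤ fejerMajorant (n + 1) (cot (π * c)) := by
  have hpc : 0 < π * c := by positivity
  have h1 : π * c ≤ π * y := by gcongr; exact hy.1
  have h2 : π * y ≤ π - π * c := by
    rw [← mul_one_sub]; gcongr; exact hy.2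
  exact (abs_deriv_fejer_le n (sin_pos_of_pos_of_lt_pi (by linarith) (by linarith)).ne').trans
    (fejerMajorant_le (by positivity) (abs_cot_le hpc ⟨h1, h2⟩))

theorem abs_deriv_fejer_add_le (n : ℕ) {t u b d : ℝ} (hd : 0 < d) (hb : 2 * b < d)
    (hu : |u| ≤ b) (ht : d ≤ |t - round t|) :
    |deriv (fejer n) (t + u)| ≤
      fejerMajorant (n + 1) (cot (π * (⌊|t - round t| / d⌋₊ * d - b))) := by
  have hper : deriv (fejer n) (t + u) = deriv (fejer n) (t - round t + u) := by
    rw [← deriv_fejer_add_intCast n (t - round t + u) (round t)]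
    congr 1; ring
  have hhalf := abs_sub_round t
  rw [hper]
  set s := t - round t
  have hk1 : (1 : ℝ) ≤ ⌊|s| / d⌋₊ := by
    exact_mod_cast Nat.le_floor (by rw [Nat.cast_one, le_div_iff₀ hd, one_mul]; exact ht)
  have hk2 : ⌊|s| / d⌋₊ * d ≤ |s| := by
    rw [← le_div_iff₀ hd]; exact Nat.floor_le (by positivity)
  have hk3 : d ≤ ⌊|s| / d⌋₊ * d := le_mul_of_one_le_left hd.le hk1
  obtain ⟨hu1, hu2⟩ := abs_le.1 hu
  rcases abs_cases s with ⟨hs, _⟩ | ⟨hs, _⟩ <;> rw [hs] at hk2 hhalf hk3 ⊢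
  · exact abs_deriv_fejer_le_of_mem_Icc n (by linarith) ⟨by linarith, by linarith⟩
  · rw [← abs_deriv_fejer_neg]
    exact abs_deriv_fejer_le_of_mem_Icc n (by linarith) ⟨by linarith, by linarith⟩

theorem natFloor_div_ne {a b d : ℝ} (hd : 0 < d) (ha : 0 ≤ a) (hb : 0 ≤ b) (h : d ≤ |a - b|) :
    ⌊a / d⌋₊ ≠ ⌊b / d⌋₊ := by
  intro heq
  have a1 := Nat.floor_le (div_nonneg ha hd.le)
  have a2 := Nat.lt_floor_add_one (a / d)
  have b1 := Nat.floor_le (div_nonneg hb hd.le)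
  have b2 := Nat.lt_floor_add_one (b / d)
  rw [heq] at a1 a2
  have hlt : |a / d - b / d| < 1 := abs_lt.2 ⟨by linarith, by linarith⟩
  rw [← sub_div, abs_div, abs_of_pos hd, div_lt_one hd] at hlt
  linarith

theorem sum_comp_le_sum_Icc_sup {ι : Type*} (R : Finset ι) (k : ι → ℕ) (f : ℕ → ℝ)
    (hf : ∀ m, 0 ≤ f m) (hk : ∀ j ∈ R, 1 ≤ k j) (hinj : Set.InjOn k R) :
    ∑ j ∈ R, f (k j) ≤ ∑ m ∈ Finset.Icc 1 (R.sup k), f m := by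
  rw [← Finset.sum_image hinj]
  refine Finset.sum_le_sum_of_subset_of_nonneg (fun m hm => ?_) fun m _ _ => hf m
  obtain ⟨j, hj, rfl⟩ := Finset.mem_image.1 hm
  exact Finset.mem_Icc.2 ⟨hk j hj, Finset.le_sup hj⟩

theorem sup_natFloor_div_mul_le {ι : Type*} (R : Finset ι) (a : ι → ℝ) {d B : ℝ} (hd : 0 < d)
    (hB : 0 ≤ B) (ha : ∀ j ∈ R, 0 ≤ a j ∧ a j ≤ B) :
    ((R.sup fun j => ⌊a j / d⌋₊ : ℕ) : ℝ) * d ≤ B := by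
  rcases R.eq_empty_or_nonempty with rfl | hR
  · simpa using hB
  · obtain ⟨j, hj, hsup⟩ := Finset.exists_mem_eq_sup R hR fun j => ⌊a j / d⌋₊
    rw [hsup, ← le_div_iff₀ hd]
    exact (Nat.floor_le (div_nonneg (ha j hj).1 hd.le)).trans (by gcongr; exact (ha j hj).2)

theorem sep_le {r : ℕ} (τ : Fin r → ℝ) {i j : Fin r} (hij : i ≠ j) (p : ℤ) :
    sep τ ≤ |τ i - τ j + p| :=
  csInf_le ⟨0, by rintro _ ⟨_, _, _, _, rfl⟩; positivity⟩ ⟨i, j, p, hij, rfl⟩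

/-- The bound obtained by telescoping along both sides of the origin. -/
theorem mul_sum_add_sum_fejerMajorant_le {M d b : ℝ} (hM : 0 < M) (hd : 0 < d) (hb0 : 0 ≤ b)
    (hb : 2 * b < d) (K L : ℕ) (hKL : K * d + L * d ≤ 1 - d) :
    d * (∑ k ∈ Finset.Icc 1 K, fejerMajorant M (cot (π * (k * d - b))) +
      ∑ k ∈ Finset.Icc 1 L, fejerMajorant M (cot (π * (k * d - b)))) ≤
      2 * fejerPotential M (cot (π * (d / 2 - b))) := by
  have hKd : 0 ≤ K * d := by positivity
  have hLd : 0 ≤ L * d := by positivity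
  have h1 := mul_sum_fejerMajorant_le hM hd hb K (by linarith)
  have h2 := mul_sum_fejerMajorant_le hM hd hb L (by linarith)
  have h3 : fejerPotential M (cot (π * (1 - (d / 2 - b + K * d)))) ≤
      fejerPotential M (cot (π * (d / 2 - b + L * d))) := by
    refine fejerPotential_mono hM (antitoneOn_cot ⟨?_, ?_⟩ ⟨?_, ?_⟩ ?_)
    · exact mul_pos pi_pos (by linarith)
    · exact mul_lt_of_lt_one_right pi_pos (by linarith)
    · exact mul_pos pi_pos (by linarith)
    · exact mul_lt_of_lt_one_right pi_pos (by linarith)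
    · gcongr; linarith
  rw [mul_one_sub, cot_pi_sub, fejerPotential_neg] at h3
  linarith

theorem fejerPotential_cot_le {M x : ℝ} (hM : 0 < M) (hx : 0 < x) (hx2 : x < 1 / 2) :
    fejerPotential M (cot (π * x)) ≤ (π * x)⁻¹ / M + (π * x)⁻¹ ^ 2 / M ^ 2 := by
  have hp : 0 < π * x := by positivity
  have hcot : cot (π * x) ≤ (π * x)⁻¹ := by
    rw [← tan_inv_eq_cot]
    exact inv_anti₀ hp (le_tan hp.le (by nlinarith [pi_pos]))
  refine (fejerPotential_mono hM hcot).trans_eq ?_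
  rw [fejerPotential, abs_of_pos (inv_pos.2 hp), ← sq]

theorem sum_abs_deriv_fejer_le_fejerPotential (n : ℕ) {r : ℕ} (τ : Fin r → ℝ) {b : ℝ}
    (hb0 : 0 ≤ b) (hb : 2 * b < sep τ) (u : Fin r → Fin r → ℝ)
    (hu : ∀ i j, i ≠ j → |u i j| ≤ b) (i : Fin r) (hr : (Finset.univ.erase i).Nonempty) :
    sep τ * ∑ j ∈ Finset.univ.erase i, |deriv (fejer n) (τ j - τ i + u i j)| ≤
      2 * fejerPotential (n + 1) (cot (π * (sep τ / 2 - b))) := by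
  have hM : (0 : ℝ) < n + 1 := by positivity
  set d := sep τ with hd_def
  have hd : 0 < d := by linarith
  set s : Fin r → ℝ := fun j => τ j - τ i - round (τ j - τ i) with hs
  have hhalf (j : Fin r) : |s j| ≤ 1 / 2 := abs_sub_round _
  have hsep0 {j : Fin r} (hj : j ≠ i) (p : ℤ) : d ≤ |s j + p| := by
    refine (sep_le τ hj (p - round (τ j - τ i))).trans_eq ?_
    push_cast; congr 1; ring
  have hsep {j l : Fin r} (hjl : j ≠ l) (p : ℤ) : d ≤ |s j - s l + p| := by
    refine (sep_le τ hjl (p - round (τ j - τ i) + round (τ l - τ i))).trans_eq ?_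
    push_cast; congr 1; simp only [hs]; ring
  have hsd {j : Fin r} (hj : j ≠ i) : d ≤ |s j| := by simpa using hsep0 hj 0
  have hd2 : d ≤ 1 / 2 := by
    obtain ⟨j, hj⟩ := hr
    exact (hsd (Finset.ne_of_mem_erase hj)).trans (hhalf j)
  set k : Fin r → ℕ := fun j => ⌊|s j| / d⌋₊ with hk
  set f : ℕ → ℝ := fun m => fejerMajorant (n + 1) (cot (π * (m * d - b))) with hf_def
  have hf (m : ℕ) : 0 ≤ f m := fejerMajorant_nonneg hM _
  have hk1 {j : Fin r} (hj : j ≠ i) : 1 ≤ k j :=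
    Nat.le_floor (by rw [Nat.cast_one, le_div_iff₀ hd, one_mul]; exact hsd hj)
  have hterm : ∀ j ∈ Finset.univ.erase i,
      |deriv (fejer n) (τ j - τ i + u i j)| ≤ f (k j) := fun j hj =>
    abs_deriv_fejer_add_le n hd hb (hu i j (Finset.ne_of_mem_erase hj).symm)
      (hsd (Finset.ne_of_mem_erase hj))
  set R := (Finset.univ.erase i).filter fun j => 0 ≤ s j with hR
  set L := (Finset.univ.erase i).filter fun j => ¬ 0 ≤ s j with hL
  have hRm {j : Fin r} (hj : j ∈ R) : j ≠ i ∧ 0 ≤ s j := by simpa [hR] using hj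
  have hLm {j : Fin r} (hj : j ∈ L) : j ≠ i ∧ s j < 0 := by simpa [hL] using hj
  have hRinj : Set.InjOn k R := by
    intro j hj l hl hjl
    by_contra hne
    refine natFloor_div_ne hd (abs_nonneg (s j)) (abs_nonneg (s l)) ?_ hjl
    rw [abs_of_nonneg (hRm hj).2, abs_of_nonneg (hRm hl).2]
    simpa using hsep hne 0
  have hLinj : Set.InjOn k L := by
    intro j hj l hl hjl
    by_contra hne
    refine natFloor_div_ne hd (abs_nonneg (s j)) (abs_nonneg (s l)) ?_ hjl
    rw [abs_of_neg (hLm hj).2, abs_of_neg (hLm hl).2, neg_sub_neg]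
    simpa using hsep (Ne.symm hne) 0
  have hcross {j l : Fin r} (hj : j ∈ R) (hl : l ∈ L) : |s j| + |s l| ≤ 1 - d := by
    have hne : j ≠ l := fun h => ((hRm hj).2.trans_lt (h ▸ (hLm hl).2)).false
    have h1 := hsep hne (-1)
    have h2 := hhalf j
    have h3 := hhalf l
    rw [abs_of_nonneg (hRm hj).2] at h2 ⊢
    rw [abs_of_neg (hLm hl).2] at h3 ⊢
    push_cast at h1
    rw [abs_of_nonpos (by linarith)] at h1
    linarith
  have hKR (l : Fin r) (hl : l ∈ L) : (R.sup k : ℕ) * d ≤ 1 - d - |s l| :=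
    sup_natFloor_div_mul_le R (fun j => |s j|) hd (by linarith [hhalf l])
      fun j hj => ⟨abs_nonneg _, by linarith [hcross hj hl]⟩
  have hKL : (R.sup k : ℕ) * d + (L.sup k : ℕ) * d ≤ 1 - d := by
    have hR2 : (R.sup k : ℕ) * d ≤ 1 / 2 :=
      sup_natFloor_div_mul_le R (fun j => |s j|) hd (by norm_num)
        fun j _ => ⟨abs_nonneg _, hhalf j⟩
    have := sup_natFloor_div_mul_le L (fun j => |s j|) hd
      (B := 1 - d - (R.sup k : ℕ) * d) (by linarith)
      fun l hl => ⟨abs_nonneg _, by linarith [hKR l hl]⟩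
    linarith
  refine le_trans ?_ (mul_sum_add_sum_fejerMajorant_le hM hd hb0 hb _ _ hKL)
  gcongr
  refine (Finset.sum_le_sum hterm).trans ?_
  rw [← Finset.sum_filter_add_sum_filter_not _ fun j => 0 ≤ s j]
  exact add_le_add
    (sum_comp_le_sum_Icc_sup R k f hf (fun j hj => hk1 (hRm hj).1) hRinj)
    (sum_comp_le_sum_Icc_sup L k f hf (fun j hj => hk1 (hLm hj).1) hLinj)

theorem sum_abs_deriv_fejer_le (n r : ℕ) (hn : 2 ≤ n) (τ : Fin r → ℝ) (α β : ℝ) (hα : 0 < α)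
    (hsep : α ≤ ((n : ℝ) + 1) * sep τ)
    (u : Fin r → Fin r → ℝ) (hu : ∀ i j, i ≠ j → ((n : ℝ) + 1) * |u i j| ≤ β)
    (hβ : β < α / 2) (i : Fin r) :
    ∑ j ∈ Finset.univ.erase i, |deriv (fejer n) (τ j - τ i + u i j)| ≤
      (((4 / π) * (α - 2 * β)⁻¹ + (8 / π ^ 2) * ((α - 2 * β)⁻¹) ^ 2) * α) * ((n : ℝ) + 1) *
        (((n : ℝ) + 1) * sep τ)⁻¹ ^ 2 := by
  have hM : (0 : ℝ) < n + 1 := by positivity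
  have hD : 0 < ((n : ℝ) + 1) * sep τ := hα.trans_le hsep
  have hd : 0 < sep τ := pos_of_mul_pos_right hD hM.le
  obtain ⟨j, hj⟩ : ∃ j, j ≠ i := by
    by_contra! hall
    have hempty : {d : ℝ | ∃ (i j : Fin r) (p : ℤ), i ≠ j ∧ d = |τ i - τ j + p|} = ∅ := by
      ext d
      simp only [Set.mem_ofPred_eq, Set.mem_empty_iff_false, iff_false]
      rintro ⟨a, b, _, hab, _⟩
      exact hab ((hall a).trans (hall b).symm)
    rw [sep, hempty, Real.sInf_empty] at hd
    exact hd.false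
  have hβ0 : 0 ≤ β := le_trans (by positivity) (hu j i hj)
  have hd2 : sep τ ≤ 1 / 2 := by
    refine (sep_le τ hj (-round (τ j - τ i))).trans ?_
    push_cast
    exact abs_sub_round _
  have hb : 2 * (β / (n + 1)) < sep τ := by
    rw [← mul_div_assoc, div_lt_iff₀ hM]; linarith
  have hb0 : 0 ≤ β / (n + 1) := by positivity
  have hmain := (sum_abs_deriv_fejer_le_fejerPotential n τ hb0 hb u
    (fun i j hij => (le_div_iff₀' hM).2 (hu i j hij)) i ⟨j, by simpa using hj⟩).trans
    (mul_le_mul_of_nonneg_left (fejerPotential_cot_le hM (by linarith) (by linarith)) two_pos.le)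
  rw [← le_div_iff₀' hd] at hmain
  refine hmain.trans ?_
  set D := ((n : ℝ) + 1) * sep τ with hD_def
  have hDβ : 0 < D - 2 * β := by linarith
  have hαβ : 0 < α - 2 * β := by linarith
  have hx : (π * (sep τ / 2 - β / (n + 1)))⁻¹ = 2 * (n + 1) / (π * (D - 2 * β)) := by
    rw [inv_eq_one_div, div_eq_div_iff (mul_pos pi_pos (by linarith)).ne' (by positivity), hD_def]
    field_simp
  have hdD : sep τ = D / (n + 1) := by rw [hD_def]; field_simp
  have hfst : (D - 2 * β)⁻¹ * D ≤ (α - 2 * β)⁻¹ * α := by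
    rw [inv_mul_eq_div, inv_mul_eq_div, div_le_div_iff₀ hDβ hαβ]
    nlinarith
  have hsnd : (D - 2 * β)⁻¹ ^ 2 * D ≤ (α - 2 * β)⁻¹ ^ 2 * α := by
    rw [sq, sq, mul_assoc, mul_assoc]
    exact mul_le_mul (inv_anti₀ hαβ (by linarith)) hfst (by positivity) (by positivity)
  rw [hx, hdD]
  calc _ = (4 / π * ((D - 2 * β)⁻¹ * D) + 8 / π ^ 2 * ((D - 2 * β)⁻¹ ^ 2 * D)) * (n + 1) *
        D⁻¹ ^ 2 := by
        field_simp
        ring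
    _ ≤ (4 / π * ((α - 2 * β)⁻¹ * α) + 8 / π ^ 2 * ((α - 2 * β)⁻¹ ^ 2 * α)) * (n + 1) *
        D⁻¹ ^ 2 := by gcongr
    _ = _ := by ring
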